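/- Let P be a transition matrix associated with G and P̄ its lift. Suppose q ∈ ℝ[X] satisfies det(1 − X • (P̄.map Polynomial.C)) = q * det(1 − X • (P.map Polynomial.C)) in ℝ[X]. Then τ(Ḡ) = q.eval 1 · τ(G), where τ(G) = ∑_{t ∈ V̄} ∏_{v ≠ root(t)} P v (t v) is the sum of the weights of the spanning trees of G and τ(Ḡ) is the sum of the weights of the spanning trees of Ḡ with edge weights given by P̄. In particular Φ_G := τ(Ḡ)/τ(G) equals R(1), the value at 1 of the polynomial R = det(I − XP̄)/det(I − XP). -/

import Mathlib

open Matrix Finset Classical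

noncomputable section

/-- A directed rooted spanning tree of the graph with edge set `E`, rooted at `r`,
encoded as the "parent" function `t`. -/
def IsSpanningTree {V : Type*} (E : Set (V × V)) (r : V) (t : V → V) : Prop :=
  t r = r ∧ (∀ v, v ≠ r → (v, t v) ∈ E) ∧ ∀ v, ∃ n, t^[n] v = r

/-- The set `V̄` of all spanning trees of the graph, over all roots, as a type:
a pair of the parent function and the root. -/
abbrev STree {V : Type*} (E : Set (V × V)) : Type _ :=
  {p : (V → V) × V // IsSpanningTree E p.2 p.1}

def STree.tree {V : Type*} {E : Set (V × V)} (t : STree E) : V → V := t.1.1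

def STree.root {V : Type*} {E : Set (V × V)} (t : STree E) : V := t.1.2

noncomputable instance STree.instFintype {V : Type*} [Finite V] {E : Set (V × V)} :
    Fintype (STree E) := Fintype.ofFinite _

/-- The edge relation of the spanning tree graph `Ḡ`. -/
def STreeEdge {V : Type*} [DecidableEq V] (E : Set (V × V)) (t t' : STree E) : Prop :=
  t.root ≠ t'.root ∧ (t.root, t'.root) ∈ E ∧
    t'.tree = Function.update (Function.update t.tree t.root t'.root) t'.root t'.root

/-- The edge set of the spanning tree graph `Ḡ`. -/
def liftEdges {V : Type*} [DecidableEq V] (E : Set (V × V)) : Set (STree E × STree E) :=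
  {p | STreeEdge E p.1 p.2}

/-- The graph `(V, E)` is strongly connected. -/
def StronglyConnected {V : Type*} (E : Set (V × V)) : Prop :=
  ∀ u v : V, Relation.ReflTransGen (fun a b => (a, b) ∈ E) u v

/-- `W` is a (nonempty) strongly connected subset of the vertices: any two vertices of `W`
are joined by a directed path staying inside `W`. -/
def StronglyConnectedSub {V : Type*} (E : Set (V × V)) (W : Finset V) : Prop :=
  W.Nonempty ∧ ∀ u ∈ W, ∀ v ∈ W,
    Relation.ReflTransGen (fun a b => a ∈ W ∧ b ∈ W ∧ (a, b) ∈ E) u v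

/-- `P` is a transition matrix associated with the graph `(V, E)`. -/
def IsTransMatrix {V : Type*} [Fintype V] (E : Set (V × V)) (P : Matrix V V ℝ) : Prop :=
  (∀ i j, 0 ≤ P i j) ∧ (∀ i, ∑ j, P i j = 1) ∧ ∀ i j, i ≠ j → (0 < P i j ↔ (i, j) ∈ E)

/-- The lift `P̄` of the matrix `P` to the spanning tree graph. -/
def liftP {V : Type*} [DecidableEq V] (E : Set (V × V)) (P : Matrix V V ℝ) :
    Matrix (STree E) (STree E) ℝ :=
  fun t t' => if t = t' then P t.root t.root
    else if STreeEdge E t t' then P t.root t'.root else 0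

/-- A directed rooted spanning forest of the graph with edge set `E`, rooted in `W`. -/
def IsSpanningForest {V : Type*} (E : Set (V × V)) (W : Finset V) (f : V → V) : Prop :=
  (∀ w ∈ W, f w = w) ∧ (∀ v, v ∉ W → (v, f v) ∈ E) ∧ ∀ v, ∃ n, f^[n] v ∈ W

/-- `k(W)`: the number of spanning forests rooted in `W`. -/
def kForest {V : Type*} (E : Set (V × V)) (W : Finset V) : ℕ :=
  Nat.card {f : V → V // IsSpanningForest E W f}

/-- The `W × W` submatrix of `A` (rows and columns indexed by `W`). -/
def subm {V : Type*} {R : Type*} (A : Matrix V V R) (W : Finset V) : Matrix W W R :=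
  A.submatrix (fun i => (i : V)) (fun j => (j : V))

/-- `Ψ_W`: the sum of the weights of the spanning forests rooted in `W`,
for edge weights `x`. -/
def forestWeightSum {V : Type*} [Fintype V] [DecidableEq V] (E : Set (V × V))
    (x : V → V → ℝ) (W : Finset V) : ℝ :=
  ∑ f ∈ Finset.univ.filter (IsSpanningForest E W),
    ∏ v ∈ Finset.univ.filter (fun v => v ∉ W), x v (f v)

/-- The weight of a spanning tree: product of edge weights over non-root vertices. -/
def treeWeight {V : Type*} [Fintype V] [DecidableEq V] {E : Set (V × V)}
    (x : V → V → ℝ) (t : STree E) : ℝ :=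
  ∏ v ∈ Finset.univ.erase t.root, x v (t.tree v)

/-- `step(t, j)`: move the root of the (rooted function) `p` along the edge to `j`. -/
def stepF {V : Type*} [DecidableEq V] (E : Set (V × V)) (p : (V → V) × V) (j : V) :
    (V → V) × V :=
  if j = p.2 then p
  else if (p.2, j) ∈ E then (Function.update (Function.update p.1 p.2 j) j j, j)
  else p

/-- `traverse(c, p)`: successively apply `step` with the vertices `c 1, c 2, …, c (n-1), c 0`. -/
def traverse {V : Type*} [DecidableEq V] (E : Set (V × V)) (n : ℕ) (c : ZMod n → V)
    (p : (V → V) × V) : (V → V) × V :=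
  (List.range n).foldl (fun q i => stepF E q (c ((i : ZMod n) + 1))) p

theorem aux_derivative_det {n : Type*} [Fintype n] [DecidableEq n]
    (A : Matrix n n (Polynomial ℝ)) :
    Polynomial.derivative A.det
      = ∑ i, (A.updateRow i (fun j => Polynomial.derivative (A i j))).det := by
  simp_rw [← Matrix.det_transpose A, ← Matrix.det_transpose (A.updateRow _ _), Matrix.det_apply']
  rw [Polynomial.derivative_sum, Finset.sum_comm]
  refine Finset.sum_congr rfl fun σ _ => ?_
  rw [Polynomial.derivative_intCast_mul, Polynomial.derivative_prod_finset, Finset.mul_sum]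
  refine Finset.sum_congr rfl fun i _ => ?_
  congr 1
  rw [← Finset.mul_prod_erase _ _ (Finset.mem_univ i), mul_comm]
  simp only [Matrix.transpose_apply, Matrix.updateRow_self]
  congr 1
  refine Finset.prod_congr rfl fun j hj => ?_
  rw [Matrix.updateRow_ne (Finset.ne_of_mem_erase hj)]

theorem aux_eval_det {n : Type*} [Fintype n] [DecidableEq n] (M : Matrix n n ℝ) :
    (Matrix.det ((1 : Matrix n n (Polynomial ℝ)) -
      (Polynomial.X : Polynomial ℝ) • (M.map Polynomial.C))).eval 1 = (1 - M).det := by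
  rw [← Polynomial.coe_evalRingHom, RingHom.map_det]
  congr 1
  ext i j
  by_cases h : i = j <;> simp [h, Matrix.one_apply]

theorem aux_det_zero {n : Type*} [Fintype n] [DecidableEq n] [Nonempty n] (M : Matrix n n ℝ)
    (hM : ∀ i, ∑ j, M i j = 1) : (1 - M).det = 0 := by
  rw [← Matrix.exists_mulVec_eq_zero_iff]
  refine ⟨fun _ => 1, ?_, ?_⟩
  · intro h
    have := congrFun h (Classical.arbitrary n)
    simp at this
  · ext i
    simp [Matrix.mulVec, dotProduct, Matrix.one_apply, hM]

theorem aux_eval_deriv {n : Type*} [Fintype n] [DecidableEq n] (M : Matrix n n ℝ)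
    (hM : ∀ i, ∑ j, M i j = 1) :
    (Polynomial.derivative (Matrix.det ((1 : Matrix n n (Polynomial ℝ)) -
      (Polynomial.X : Polynomial ℝ) • (M.map Polynomial.C)))).eval 1
      = - ∑ r, ((1 - M).updateRow r (Pi.single r 1)).det := by
  rw [aux_derivative_det, Polynomial.eval_finsetSum, ← Finset.sum_neg_distrib]
  refine Finset.sum_congr rfl fun r _ => ?_
  have : Nonempty n := ⟨r⟩
  have h0 := aux_det_zero M hM
  have h1 : ((1 - M).updateRow r ((-1 : ℝ) • (Pi.single r 1) + (1 - M) r)).det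
      = - ((1 - M).updateRow r (Pi.single r 1)).det := by
    rw [Matrix.det_updateRow_add, Matrix.det_updateRow_smul, Matrix.updateRow_eq_self, h0]
    ring
  rw [← h1, ← Polynomial.coe_evalRingHom, RingHom.map_det]
  congr 1
  ext i j
  by_cases hi : i = r
  · subst hi
    by_cases h : i = j
    · subst h; simp [Matrix.one_apply]; ring
    · simp [h, Matrix.one_apply, Pi.single_apply, Ne.symm h]
  · simp only [RingHom.mapMatrix_apply, Matrix.map_apply, Matrix.updateRow_ne hi]
    by_cases h : i = j <;> simp [h, Matrix.one_apply]

/-- the matrix of a function with a marked vertex -/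
def auxB {n : Type*} [DecidableEq n] (r : n) (f : n → n) : Matrix n n ℝ :=
  fun v => if v = r then Pi.single r 1 else Pi.single v 1 - Pi.single (f v) 1

theorem auxB_not {n : Type*} [Fintype n] [DecidableEq n] (r : n) (f : n → n)
    (h : ¬ ∀ v, ∃ k, f^[k] v = r) : (auxB r f).det = 0 := by
  push Not at h
  obtain ⟨v, hv⟩ := h
  rw [← Matrix.exists_mulVec_eq_zero_iff]
  refine ⟨fun w => if ∃ k, f^[k] w = r then 0 else 1, ?_, ?_⟩
  · intro h
    have := congrFun h v
    simp [hv] at this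
  · ext w
    by_cases hw : w = r
    · subst hw
      simp only [Matrix.mulVec, auxB, if_true, single_dotProduct, Pi.zero_apply, one_mul]
      rw [if_pos ⟨0, rfl⟩]
    · have : (∃ k, f^[k] w = r) ↔ (∃ k, f^[k] (f w) = r) := by
        constructor
        · rintro ⟨k, hk⟩
          cases k with
          | zero => exact absurd hk hw
          | succ k => exact ⟨k, hk⟩
        · rintro ⟨k, hk⟩
          exact ⟨k + 1, hk⟩
      simp only [Matrix.mulVec, auxB, if_neg hw, sub_dotProduct, single_dotProduct,
        Pi.zero_apply, one_mul, this, sub_self]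

theorem auxB_tree {n : Type*} [Fintype n] [DecidableEq n] (r : n) (f : n → n)
    (h : ∀ v, ∃ k, f^[k] v = r) : (auxB r f).det = 1 := by
  let d : n → ℕ := fun v => Nat.find (h v)
  have hd : ∀ v, v ≠ r → d (f v) < d v := by
    intro v hv
    have h1 : f^[d v] v = r := Nat.find_spec (h v)
    rcases hk : d v with _ | k
    · rw [hk] at h1; exact absurd h1 hv
    · rw [hk] at h1
      exact Nat.lt_succ_of_le (Nat.find_min' (h (f v)) h1)
  have hB : (auxB r f)ᵀ.BlockTriangular d := by
    intro i j hij
    simp only [Matrix.transpose_apply, auxB]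
    split_ifs with hj
    · subst hj
      have : i ≠ j := by rintro rfl; exact lt_irrefl _ hij
      simp [this]
    · have h1 : i ≠ j := by rintro rfl; exact lt_irrefl _ hij
      have h2 : i ≠ f j := by rintro rfl; exact lt_asymm hij (hd j hj)
      simp [h1, h2]
  rw [← Matrix.det_transpose, hB.det]
  refine Finset.prod_eq_one fun a _ => ?_
  suffices hone : (auxB r f)ᵀ.toSquareBlock d a = 1 by rw [hone, Matrix.det_one]
  ext ⟨i, hi⟩ ⟨j, hj⟩
  simp only [Matrix.toSquareBlock_def, Matrix.of_apply, Matrix.transpose_apply, auxB,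
    Matrix.one_apply, Subtype.mk.injEq]
  split_ifs with h1 h2 h2
  · subst h2; subst h1; simp
  · subst h1; simp [h2]
  · subst h2
    have : i ≠ f i := by intro h; have := hd i h1; rw [← h] at this; exact lt_irrefl _ this
    simp [this]
  · have : i ≠ f j := by
      rintro rfl; have := hd j h1; omega
    simp [this, h2]

theorem aux_minor {n : Type*} [Fintype n] [DecidableEq n] (M : Matrix n n ℝ)
    (hM : ∀ i, ∑ j, M i j = 1) (r : n) :
    ((1 - M).updateRow r (Pi.single r 1)).det
      = ∑ f : n → n, if f r = r ∧ ∀ v, ∃ k, f^[k] v = r then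
          ∏ v ∈ Finset.univ.erase r, M v (f v) else 0 := by
  let c : n → n → ℝ := fun v w => if v = r then (if w = r then 1 else 0) else M v w
  let g : n → n → n → ℝ := fun v w =>
    c v w • (if v = r then Pi.single r 1 else Pi.single v 1 - Pi.single w 1)
  have h1 : (1 - M).updateRow r (Pi.single r 1) = Matrix.of (fun v => ∑ w, g v w) := by
    ext v j
    by_cases hv : v = r
    · subst hv
      simp [g, c, Finset.sum_apply]
    · simp only [Matrix.updateRow_ne hv, Matrix.of_apply, Finset.sum_apply, g, c, hv, if_false,
        Pi.smul_apply, Pi.sub_apply, smul_eq_mul, mul_sub, Finset.sum_sub_distrib,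
        ← Finset.sum_mul, hM, Matrix.sub_apply, one_mul]
      congr 1
      · simp [Matrix.one_apply, Pi.single_apply, eq_comm]
      · simp [Pi.single_apply]
  rw [h1]
  have h2 := (Matrix.detRowAlternating (R := ℝ) (n := n)).toMultilinearMap.map_sum g
  refine Eq.trans h2 ?_
  refine Finset.sum_congr rfl fun f _ => ?_
  have h3 := (Matrix.detRowAlternating (R := ℝ) (n := n)).toMultilinearMap.map_smul_univ
    (fun v => c v (f v)) (auxB r f)
  refine Eq.trans h3 ?_
  change (∏ v, c v (f v)) * (auxB r f).det = _
  have h4 : ∏ v ∈ Finset.univ.erase r, c v (f v) = ∏ v ∈ Finset.univ.erase r, M v (f v) :=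
    Finset.prod_congr rfl fun v hv => by simp [c, Finset.ne_of_mem_erase hv]
  rw [← Finset.mul_prod_erase _ _ (Finset.mem_univ r), h4]
  by_cases hr : f r = r
  · by_cases ht : ∀ v, ∃ k, f^[k] v = r
    · rw [auxB_tree r f ht, if_pos ⟨hr, ht⟩]; simp [c, hr]
    · rw [auxB_not r f ht, if_neg (fun h => ht h.2)]; simp
  · rw [if_neg (fun h => hr h.1)]; simp [c, hr]

theorem aux_iter_fix {n : Type*} (f : n → n) (v : n) (h : f v = v) (k : ℕ) : f^[k] v = v :=
  Function.iterate_fixed h k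

theorem aux_tau {n : Type*} [Fintype n] [DecidableEq n] (E : Set (n × n)) (M : Matrix n n ℝ)
    (hM : ∀ i, ∑ j, M i j = 1) (hE : ∀ i j, i ≠ j → (i, j) ∉ E → M i j = 0) :
    ∑ T : STree E, ∏ v ∈ Finset.univ.erase T.root, M v (T.tree v)
      = ∑ r, ((1 - M).updateRow r (Pi.single r 1)).det := by
  simp_rw [aux_minor M hM]
  rw [Finset.sum_comm]
  rw [← Fintype.sum_prod_type' (f := fun (f : n → n) (r : n) =>
    if f r = r ∧ ∀ v, ∃ k, f^[k] v = r then ∏ v ∈ Finset.univ.erase r, M v (f v) else 0)]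
  have h1 : ∀ p : (n → n) × n,
      (if p.1 p.2 = p.2 ∧ ∀ v, ∃ k, p.1^[k] v = p.2 then
        ∏ v ∈ Finset.univ.erase p.2, M v (p.1 v) else 0)
      = if IsSpanningTree E p.2 p.1 then ∏ v ∈ Finset.univ.erase p.2, M v (p.1 v) else 0 := by
    rintro ⟨f, r⟩
    by_cases ht : IsSpanningTree E r f
    · rw [if_pos ⟨ht.1, ht.2.2⟩, if_pos ht]
    · rw [if_neg ht]
      split_ifs with hc
      · have : ∃ v, v ≠ r ∧ (v, f v) ∉ E := by
          by_contra hcon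
          push Not at hcon
          exact ht ⟨hc.1, hcon, hc.2⟩
        obtain ⟨v, hv, hvE⟩ := this
        refine Finset.prod_eq_zero (Finset.mem_erase.2 ⟨hv, Finset.mem_univ v⟩) ?_
        refine hE _ _ ?_ hvE
        intro hfv
        obtain ⟨k, hk⟩ := hc.2 v
        rw [aux_iter_fix f v hfv.symm] at hk
        exact hv hk
      · rfl
  simp_rw [h1]
  rw [← Finset.sum_filter]
  symm
  refine Finset.sum_subtype _ (fun p => ?_) _
  simp

/-- Moving the root of a spanning tree gives a spanning tree. -/
theorem aux_step {V : Type*} [DecidableEq V] (E : Set (V × V)) (t : STree E) (j : V)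
    (hj : j ≠ t.root) (hE : (t.root, j) ∈ E) :
    IsSpanningTree E j (Function.update (Function.update t.tree t.root j) j j) := by
  obtain ⟨⟨f, r⟩, h1, h2, h3⟩ := t
  simp only [STree.root, STree.tree] at *
  set g := Function.update (Function.update f r j) j j with hg
  have gj : g j = j := by simp [hg]
  have gr : g r = j := by simp [hg, hj.symm]
  have go : ∀ v, v ≠ j → v ≠ r → g v = f v := fun v a b => by simp [hg, a, b]
  refine ⟨gj, ?_, ?_⟩
  · intro v hv
    by_cases hr : v = r
    · subst hr; rw [gr]; exact hE
    · rw [go v hv hr]; exact h2 v hr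
  · have key : ∀ k v, f^[k] v = r → ∃ m, g^[m] v = j := by
      intro k
      induction k with
      | zero => rintro v rfl; exact ⟨1, gr⟩
      | succ k ih =>
        intro v hv
        by_cases hvj : v = j
        · exact ⟨0, hvj⟩
        by_cases hvr : v = r
        · subst hvr; exact ⟨1, gr⟩
        obtain ⟨m, hm⟩ := ih (f v) hv
        refine ⟨m + 1, ?_⟩
        rw [Function.iterate_succ_apply, go v hvj hvr]
        exact hm
    intro v
    obtain ⟨k, hk⟩ := h3 v
    exact key k v hk

theorem aux_root_eq {V : Type*} [DecidableEq V] (E : Set (V × V)) (t t' t'' : STree E)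
    (h : STreeEdge E t t') (h' : STreeEdge E t t'') (hr : t'.root = t''.root) : t' = t'' := by
  obtain ⟨_, _, a⟩ := h
  obtain ⟨_, _, b⟩ := h'
  rw [hr] at a
  exact Subtype.ext (Prod.ext (a.trans b.symm) hr)

theorem aux_lift_sum {V : Type*} [Fintype V] [DecidableEq V]
    (E : Set (V × V)) (hloop : ∀ v : V, (v, v) ∉ E)
    (P : Matrix V V ℝ) (hP : IsTransMatrix E P) (t : STree E) :
    ∑ t', liftP E P t t' = 1 := by
  obtain ⟨h0, hs, hpos⟩ := hP
  rw [← hs t.root, ← Finset.sum_fiberwise (Finset.univ) (fun t' : STree E => t'.root)]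
  refine Finset.sum_congr rfl fun j _ => ?_
  by_cases hj : j = t.root
  · subst hj
    rw [Finset.sum_eq_single t]
    · simp [liftP]
    · intro b hb hbt
      simp only [Finset.mem_filter, Finset.mem_univ, true_and] at hb
      simp only [liftP]
      rw [if_neg (Ne.symm hbt), if_neg (fun h => h.1 hb.symm)]
    · simp
  · by_cases hE : (t.root, j) ∈ E
    · let s : STree E := ⟨(_, j), aux_step E t j hj hE⟩
      have hsr : s.root = j := rfl
      have hedge : STreeEdge E t s := ⟨Ne.symm hj, hE, rfl⟩
      rw [Finset.sum_eq_single s]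
      · have : t ≠ s := by intro h; exact hj (hsr.symm.trans (congrArg STree.root h.symm))
        simp only [liftP]
        rw [if_neg this, if_pos hedge, hsr]
      · intro b hb hbs
        simp only [Finset.mem_filter, Finset.mem_univ, true_and] at hb
        have : t ≠ b := by rintro rfl; exact hj hb.symm
        simp only [liftP]
        rw [if_neg this, if_neg]
        intro h
        exact hbs (aux_root_eq E t b s h hedge (hb.trans hsr.symm))
      · simp [hsr]
    · have : P t.root j = 0 := by
        by_contra hne
        exact hE ((hpos _ _ (Ne.symm hj)).1 (lt_of_le_of_ne (h0 _ _) (Ne.symm hne)))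
      rw [this]
      refine Finset.sum_eq_zero fun b hb => ?_
      simp only [Finset.mem_filter, Finset.mem_univ, true_and] at hb
      have h1 : t ≠ b := by rintro rfl; exact hj hb.symm
      simp only [liftP]
      rw [if_neg h1, if_neg]
      rintro ⟨_, h, _⟩
      rw [hb] at h
      exact hE h

/-- if `det(I - XP̄) = q · det(I - XP)` in `ℝ[X]`, then
`τ(Ḡ) = q(1) · τ(G)`; i.e. `Φ_G = τ(Ḡ)/τ(G) = R(1)`. -/
theorem stmt12 {V : Type*} [Fintype V] [DecidableEq V] [Nonempty V]
    (E : Set (V × V)) (hloop : ∀ v : V, (v, v) ∉ E) (hconn : StronglyConnected E)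
    (P : Matrix V V ℝ) (hP : IsTransMatrix E P)
    (q : Polynomial ℝ)
    (hq : Matrix.det ((1 : Matrix (STree E) (STree E) (Polynomial ℝ)) -
            (Polynomial.X : Polynomial ℝ) • ((liftP E P).map Polynomial.C))
          = q * Matrix.det ((1 : Matrix V V (Polynomial ℝ)) -
            (Polynomial.X : Polynomial ℝ) • (P.map Polynomial.C))) :
    (∑ T : STree (liftEdges E),
        ∏ t ∈ Finset.univ.erase T.root, liftP E P t (T.tree t))
      = q.eval 1 * ∑ t : STree E, ∏ v ∈ Finset.univ.erase t.root, P v (t.tree v) := by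
  have hP0 := hP
  obtain ⟨h0, hs, hpos⟩ := hP
  have hl := aux_lift_sum E hloop P hP0
  rw [aux_tau (liftEdges E) (liftP E P) hl ?_, aux_tau E P hs ?_]
  · have hd := congrArg (fun p => (Polynomial.derivative p).eval 1) hq
    simp only [Polynomial.derivative_mul, Polynomial.eval_add, Polynomial.eval_mul] at hd
    rw [aux_eval_deriv _ hl, aux_eval_deriv _ hs, aux_eval_det, aux_det_zero P hs] at hd
    linarith
  · intro i j hij hE
    by_contra hne
    exact hE ((hpos _ _ hij).1 (lt_of_le_of_ne (h0 _ _) (Ne.symm hne)))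
  · intro t t' hij hE
    simp only [liftP]
    have hE' : ¬ STreeEdge E t t' := hE
    rw [if_neg hij, if_neg hE']
end
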